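/- Fix integers T ≥ 1, t with 1 ≤ t ≤ T, H ≥ 1, integers N_F ≥ 1 and N_P ≥ 1, δ ∈ (0,1), and β_r, β_P > 0. Let f_⋆, f̂_t : C × S × A → [0,1], let P_⋆ and P̂_t be context-dependent dynamics, and let π_1, …, π_{t−1} ∈ Π_C define the bonuses b^R_t, b^P_t. Define the optimistic MDP M̂_t(c) := (S, A, P̂^c_t, r̂^c_t, s_0, H) where r̂^c_t(s,a) := f̂_t(c,s,a) + b^R_t(c,s,a) + b^P_t(c,s,a), write M(c) := M^{(f_⋆,P_⋆)}(c), and define the contextual potential φ_t(π) := E_c[ Σ_{h=0}^{H−1} Σ_{s∈S_h} Σ_{a∈A} q_h(s,a|π(c;·),P̂^c_t) / (1 + Σ_{i=1}^{t−1} q_h(s,a|π_i(c;·),P̂^c_t)) ]. Assume the confidence bound: for every π ∈ Π_C, | E_c[ V^{π(c;·)}_{M(c)}(s_0) − V^{π(c;·)}_{M^{(f̂_t,P̂_t)}(c)}(s_0) ] | ≤ (112H³/β_r) · log(18T⁴H·N_F·N_P/δ²) + (157H⁴/β_P) · log(3TH·N_P/δ) + E_c[ Σ_{h=0}^{H−1}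 Σ_{s∈S_h} Σ_{a∈A} q_h(s,a|π(c;·),P̂^c_t) · ( b^R_t(c,s,a) + b^P_t(c,s,a) ) ]. Then for every context-dependent policy π_t ∈ Π_C: E_c[ V^{π_t(c;·)}_{M̂_t(c)}(s_0) ] ≤ E_c[ V^{π_t(c;·)}_{M(c)}(s_0) ] + (β_r + H·β_P) · φ_t(π_t) + (157H⁴/β_P) · log(3TH·N_P/δ) + (112H³/β_r) · log(18T⁴H·N_F·N_P/δ²). -/

import Mathlib

open scoped BigOperators Classical
open Finset

noncomputable section

/-- Squared Hellinger distance between two distributions on a finite set. -/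
def hellingerSq {X : Type*} [Fintype X] (P Q : X → ℝ) : ℝ :=
  ∑ x, (Real.sqrt (P x) - Real.sqrt (Q x)) ^ 2

variable {S : ℕ → Type} [∀ h, Fintype (S h)] {A : Type} [Fintype A]

/-- Value function of a deterministic policy in a layered MDP, defined by the backward
Bellman recursion: `val P r pol k h s` is the value with `k` steps to go, starting at
state `s` in layer `h`.  The layer-`h` value function of the horizon-`H` MDP is
`val P r pol (H - h) h`. -/
def val (P : ∀ h, S h → A → S (h + 1) → ℝ) (r : ∀ h, S h → A → ℝ)
    (pol : ∀ h, S h → A) : (k : ℕ) → (h : ℕ) → S h → ℝ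
  | 0, _, _ => 0
  | k + 1, h, s =>
      r h s (pol h s) + ∑ s' : S (h + 1), P h s (pol h s) s' * val P r pol k (h + 1) s'

/-- State-occupancy measure: `stateOcc P pol h0 st k s` is the probability of being at
state `s` in layer `h0 + k` when acting with the deterministic policy `pol` under
dynamics `P`, starting from state `st` in layer `h0`. -/
def stateOcc (P : ∀ h, S h → A → S (h + 1) → ℝ) (pol : ∀ h, S h → A)
    (h0 : ℕ) (st : S h0) : (k : ℕ) → S (h0 + k) → ℝ
  | 0, s => if s = st then 1 else 0
  | k + 1, s' =>
      ∑ s : S (h0 + k), stateOcc P pol h0 st k s * P (h0 + k) s (pol (h0 + k) s) s'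

/-- State-action occupancy measure started at `st` in layer `h0`. -/
def occ (P : ∀ h, S h → A → S (h + 1) → ℝ) (pol : ∀ h, S h → A)
    (h0 : ℕ) (st : S h0) (k : ℕ) (s : S (h0 + k)) (a : A) : ℝ :=
  if a = pol (h0 + k) s then stateOcc P pol h0 st k s else 0

/-- State-occupancy measure started from the initial state `s0` of layer `0`:
probability of being at state `s` in layer `h`. -/
def stateOcc0 (P : ∀ h, S h → A → S (h + 1) → ℝ) (pol : ∀ h, S h → A)
    (s0 : S 0) : (h : ℕ) → S h → ℝ
  | 0, s => if s = s0 then 1 else 0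
  | h + 1, s' => ∑ s : S h, stateOcc0 P pol s0 h s * P h s (pol h s) s'

/-- State-action occupancy measure `q_h(s, a | pol, P)` started from the initial state. -/
def occ0 (P : ∀ h, S h → A → S (h + 1) → ℝ) (pol : ∀ h, S h → A)
    (s0 : S 0) (h : ℕ) (s : S h) (a : A) : ℝ :=
  if a = pol h s then stateOcc0 P pol s0 h s else 0


variable {C : Type} [Fintype C]

/-- Reward bonus `b^R_t(c,s,a)` built from the past policies `pols 0, …, pols (t-2)`
(representing `π_1, …, π_{t-1}`) and the approximated dynamics `Phat`. -/
def bonusR (Phat : C → ∀ h, S h → A → S (h + 1) → ℝ)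
    (pols : ℕ → C → ∀ h, S h → A) (s0 : S 0) (t : ℕ) (br : ℝ)
    (c : C) (h : ℕ) (s : S h) (a : A) : ℝ :=
  min 1 ((br / 2) / (1 + ∑ i ∈ Finset.range (t - 1), occ0 (Phat c) (pols i c) s0 h s a))

/-- Reward bonus `b^P_t(c,s,a)` built from the past policies `pols 0, …, pols (t-2)`
(representing `π_1, …, π_{t-1}`) and the approximated dynamics `Phat`. -/
def bonusP (Phat : C → ∀ h, S h → A → S (h + 1) → ℝ)
    (pols : ℕ → C → ∀ h, S h → A) (s0 : S 0) (t : ℕ) (bp : ℝ) (H : ℕ)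
    (c : C) (h : ℕ) (s : S h) (a : A) : ℝ :=
  min (H : ℝ)
    ((bp * H / 2) / (1 + ∑ i ∈ Finset.range (t - 1), occ0 (Phat c) (pols i c) s0 h s a))

/-- One Bellman step, averaged against the state-occupancy measure. -/
theorem sum_stateOcc0_mul_val_succ (P : ∀ h, S h → A → S (h + 1) → ℝ)
    (r : ∀ h, S h → A → ℝ) (pol : ∀ h, S h → A) (s0 : S 0) (k h : ℕ) :
    (∑ s : S h, stateOcc0 P pol s0 h s * _root_.val P r pol (k + 1) h s) =
      (∑ s : S h, stateOcc0 P pol s0 h s * r h s (pol h s)) +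
        ∑ s' : S (h + 1), stateOcc0 P pol s0 (h + 1) s' * _root_.val P r pol k (h + 1) s' := by
  simp only [_root_.val, stateOcc0, mul_add, Finset.sum_add_distrib, Finset.mul_sum, Finset.sum_mul]
  congr 1
  rw [Finset.sum_comm]
  simp only [mul_assoc]

theorem sum_stateOcc0_mul_val (P : ∀ h, S h → A → S (h + 1) → ℝ)
    (r : ∀ h, S h → A → ℝ) (pol : ∀ h, S h → A) (s0 : S 0) (k h : ℕ) :
    (∑ s : S h, stateOcc0 P pol s0 h s * _root_.val P r pol k h s) =
      ∑ j ∈ Finset.Ico h (h + k), ∑ s : S j, stateOcc0 P pol s0 j s * r j s (pol j s) := by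
  induction k generalizing h with
  | zero => simp [_root_.val]
  | succ k ih =>
    rw [sum_stateOcc0_mul_val_succ, ih,
      Finset.sum_eq_sum_Ico_succ_bot (show h < h + (k + 1) by omega),
      show h + 1 + k = h + (k + 1) by omega]

/-- The value of a policy is the occupancy-weighted sum of rewards. -/
theorem val_eq_sum_occ0 (P : ∀ h, S h → A → S (h + 1) → ℝ)
    (r : ∀ h, S h → A → ℝ) (pol : ∀ h, S h → A) (s0 : S 0) (H : ℕ) :
    _root_.val P r pol H 0 s0 =
      ∑ h ∈ Finset.range H, ∑ s : S h, ∑ a : A, occ0 P pol s0 h s a * r h s a := by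
  calc _root_.val P r pol H 0 s0
      = ∑ s : S 0, stateOcc0 P pol s0 0 s * _root_.val P r pol H 0 s := by simp [stateOcc0]
    _ = _ := by
      rw [sum_stateOcc0_mul_val, Nat.zero_add, Finset.range_eq_Ico]
      simp [occ0, ite_mul]

theorem stateOcc0_nonneg {P : ∀ h, S h → A → S (h + 1) → ℝ} {H : ℕ}
    (hP : ∀ h, h < H → ∀ s a s', 0 ≤ P h s a s') (pol : ∀ h, S h → A) (s0 : S 0)
    {h : ℕ} (hh : h ≤ H) (s : S h) : 0 ≤ stateOcc0 P pol s0 h s := by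
  induction h with
  | zero => unfold stateOcc0; split_ifs <;> norm_num
  | succ h ih =>
    exact Finset.sum_nonneg fun s' _ => mul_nonneg (ih (by omega) s') (hP h hh _ _ _)

theorem occ0_nonneg {P : ∀ h, S h → A → S (h + 1) → ℝ} {H : ℕ}
    (hP : ∀ h, h < H → ∀ s a s', 0 ≤ P h s a s') (pol : ∀ h, S h → A) (s0 : S 0)
    {h : ℕ} (hh : h ≤ H) (s : S h) (a : A) : 0 ≤ occ0 P pol s0 h s a := by
  unfold occ0
  split_ifs
  exacts [stateOcc0_nonneg hP pol s0 hh s, le_rfl]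

/-- The cost of optimism (`lemma:optimism-cost-main`): under the confidence bound, the
expected optimistic value of any policy exceeds its true expected value by at most the
contextual-potential term plus the stated additive error. -/
theorem stmt12
    (H : ℕ) (hH : 1 ≤ H)
    (s0 : S 0) (hS0 : ∀ s : S 0, s = s0)
    (D : C → ℝ) (hD0 : ∀ c, 0 ≤ D c) (hD1 : (∑ c, D c) = 1)
    (T t : ℕ) (hT : 1 ≤ T) (ht : 1 ≤ t) (htT : t ≤ T)
    (NF NP : ℕ) (hNF : 1 ≤ NF) (hNP : 1 ≤ NP)
    (del : ℝ) (hdel0 : 0 < del) (hdel1 : del < 1)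
    (br bp : ℝ) (hbr : 0 < br) (hbp : 0 < bp)
    (fstar fhat : C → ∀ h, S h → A → ℝ)
    (hfstar : ∀ c h s a, 0 ≤ fstar c h s a ∧ fstar c h s a ≤ 1)
    (hfhat : ∀ c h s a, 0 ≤ fhat c h s a ∧ fhat c h s a ≤ 1)
    (Pstar Phat : C → ∀ h, S h → A → S (h + 1) → ℝ)
    (hPstar0 : ∀ c h, h < H → ∀ s a s', 0 ≤ Pstar c h s a s')
    (hPstar1 : ∀ c h, h < H → ∀ s a, (∑ s', Pstar c h s a s') = 1)
    (hPhat0 : ∀ c h, h < H → ∀ s a s', 0 ≤ Phat c h s a s')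
    (hPhat1 : ∀ c h, h < H → ∀ s a, (∑ s', Phat c h s a s') = 1)
    (pols : ℕ → C → ∀ h, S h → A)
    -- the optimistic reward of the approximated optimistic MDP `M̂_t(c)`
    (rhat : C → ∀ h, S h → A → ℝ)
    (hrhat : ∀ c h (s : S h) a,
      rhat c h s a =
        fhat c h s a + bonusR Phat pols s0 t br c h s a +
          bonusP Phat pols s0 t bp H c h s a)
    -- confidence bound (the good event of `corl:UCB-value-main`)
    (hCB : ∀ pol : C → ∀ h, S h → A,
      |∑ c, D c * (val (Pstar c) (fstar c) (pol c) H 0 s0 -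
          val (Phat c) (fhat c) (pol c) H 0 s0)| ≤
        (112 * (H : ℝ) ^ 3 / br) *
            Real.log (18 * (T : ℝ) ^ 4 * H * NF * NP / del ^ 2) +
          (157 * (H : ℝ) ^ 4 / bp) * Real.log (3 * (T : ℝ) * H * NP / del) +
          (∑ c, D c * ∑ h ∈ Finset.range H, ∑ s : S h, ∑ a : A,
            occ0 (Phat c) (pol c) s0 h s a *
              (bonusR Phat pols s0 t br c h s a +
                bonusP Phat pols s0 t bp H c h s a))) :
    ∀ polt : C → ∀ h, S h → A,
      (∑ c, D c * val (Phat c) (rhat c) (polt c) H 0 s0) ≤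
        (∑ c, D c * val (Pstar c) (fstar c) (polt c) H 0 s0) +
          (br + (H : ℝ) * bp) *
            (∑ c, D c * ∑ h ∈ Finset.range H, ∑ s : S h, ∑ a : A,
              occ0 (Phat c) (polt c) s0 h s a /
                (1 + ∑ i ∈ Finset.range (t - 1), occ0 (Phat c) (pols i c) s0 h s a)) +
          (157 * (H : ℝ) ^ 4 / bp) * Real.log (3 * (T : ℝ) * H * NP / del) +
          (112 * (H : ℝ) ^ 3 / br) *
            Real.log (18 * (T : ℝ) ^ 4 * H * NF * NP / del ^ 2) := by
  intro polt
  set φ := ∑ c, D c * ∑ h ∈ Finset.range H, ∑ s : S h, ∑ a : A,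
    occ0 (Phat c) (polt c) s0 h s a /
      (1 + ∑ i ∈ Finset.range (t - 1), occ0 (Phat c) (pols i c) s0 h s a) with hφ
  set B := ∑ c, D c * ∑ h ∈ Finset.range H, ∑ s : S h, ∑ a : A,
    occ0 (Phat c) (polt c) s0 h s a *
      (bonusR Phat pols s0 t br c h s a + bonusP Phat pols s0 t bp H c h s a) with hB
  have hopt : (∑ c, D c * val (Phat c) (rhat c) (polt c) H 0 s0) =
      (∑ c, D c * val (Phat c) (fhat c) (polt c) H 0 s0) + B := by
    simp only [hB, val_eq_sum_occ0, hrhat, add_assoc, mul_add, Finset.sum_add_distrib]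
  have hbonus : 2 * B ≤ (br + (H : ℝ) * bp) * φ := by
    have hle : B ≤ ((br + (H : ℝ) * bp) / 2) * φ := by
      rw [hB, hφ, Finset.mul_sum]
      refine Finset.sum_le_sum fun c _ => ?_
      rw [mul_left_comm]
      refine mul_le_mul_of_nonneg_left ?_ (hD0 c)
      simp only [Finset.mul_sum]
      refine Finset.sum_le_sum fun h hh => Finset.sum_le_sum fun s _ =>
        Finset.sum_le_sum fun a _ => ?_
      have hq := occ0_nonneg (hPhat0 c) (polt c) s0 (Finset.mem_range.1 hh).le s a
      refine (mul_le_mul_of_nonneg_left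
        (add_le_add (min_le_right _ _) (min_le_right _ _)) hq).trans_eq ?_
      ring
    linarith
  have hconf := (abs_le.1 (hCB polt)).1
  simp only [mul_sub, Finset.sum_sub_distrib] at hconf
  rw [← hB] at hconf
  linarith

end
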